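/- Assume in addition p > r!. For every nonzero prime ideal 𝔩 of A with 𝔩 ≠ (T) and every 𝔽_𝔩-subspace X of φ[𝔩] with X ≠ 0, X ≠ φ[𝔩], and σ(X) = X for all σ ∈ Gal(F̄/F), one has 2 ≤ dim_{𝔽_𝔩} X ≤ r − 2; that is, φ[𝔩] has no Galois-stable 𝔽_𝔩-subspace of dimension 1 or of codimension 1. -/

import Mathlib

open Polynomial

noncomputable section

/-- `F̄`: a fixed algebraic closure of `F = 𝔽_q(T)`. -/
abbrev Kbar (Fq : Type) [Field Fq] := AlgebraicClosure (RatFunc Fq)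

/-- `φ` is (encodes) the rank-`r` Drinfeld `𝔽_q[T]`-module over `𝔽_q(T)` given by
`φ_T = T + τ^{r-1} + T^{q-1} τ^r`: it is a ring homomorphism from `A = 𝔽_q[T]` to the
additive endomorphisms of `F̄` which is `𝔽_q`-linear (the condition on `C c`) and sends
`T` to `x ↦ T·x + x^{q^{r-1}} + T^{q-1}·x^{q^r}`. -/
def IsDrinfeldPhi (Fq : Type) [Field Fq] (q r : ℕ)
    (φ : Polynomial Fq →+* AddMonoid.End (Kbar Fq)) : Prop :=
  (∀ (c : Fq) (x : Kbar Fq),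
      φ (C c) x = algebraMap (RatFunc Fq) (Kbar Fq) (RatFunc.C c) * x) ∧
  (∀ x : Kbar Fq, φ X x =
      algebraMap (RatFunc Fq) (Kbar Fq) RatFunc.X * x + x ^ q ^ (r - 1) +
        algebraMap (RatFunc Fq) (Kbar Fq) RatFunc.X ^ (q - 1) * x ^ q ^ r)

/-- The `a`-torsion `φ[a] ⊆ F̄`. -/
def phiTorsion (Fq : Type) [Field Fq] (φ : Polynomial Fq →+* AddMonoid.End (Kbar Fq))
    (a : Polynomial Fq) : Set (Kbar Fq) := {x | φ a x = 0}

/-- `g` is an `A/(a)`-module automorphism of `φ[a]`: a bijection of `φ[a]` with itself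
which is additive and commutes with the `A`-action through `φ`. -/
def IsTorsionAut (Fq : Type) [Field Fq] (φ : Polynomial Fq →+* AddMonoid.End (Kbar Fq))
    (a : Polynomial Fq) (g : Kbar Fq → Kbar Fq) : Prop :=
  Set.BijOn g (phiTorsion Fq φ a) (phiTorsion Fq φ a) ∧
  (∀ x ∈ phiTorsion Fq φ a, ∀ y ∈ phiTorsion Fq φ a, g (x + y) = g x + g y) ∧
  (∀ b : Polynomial Fq, ∀ x ∈ phiTorsion Fq φ a, g (φ b x) = φ b (g x))

/-- `V` is a Galois-stable `𝔽_𝔩`-subspace of `φ[𝔩]` (for `𝔩 = (l)`): a subset of the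
`l`-torsion containing `0`, closed under addition and under the `A`-action through `φ`
(hence an `A/𝔩 = 𝔽_𝔩`-subspace), and stable under `Gal(F̄/F)`. -/
def IsGaloisStableSubspace (Fq : Type) [Field Fq]
    (φ : Polynomial Fq →+* AddMonoid.End (Kbar Fq)) (l : Polynomial Fq)
    (V : Set (Kbar Fq)) : Prop :=
  V ⊆ phiTorsion Fq φ l ∧ (0 : Kbar Fq) ∈ V ∧
  (∀ x ∈ V, ∀ y ∈ V, x + y ∈ V) ∧
  (∀ b : Polynomial Fq, ∀ x ∈ V, φ b x ∈ V) ∧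
  (∀ σ : Kbar Fq ≃ₐ[RatFunc Fq] Kbar Fq, ∀ x ∈ V, σ x ∈ V)

section Valuation

variable {k K Γ : Type*} [Field k] [Field K] [Algebra k K]
  [LinearOrderedCommGroupWithZero Γ]

lemma pow_card_sub_eq_prod [Fintype k] (z : K) :
    z ^ Fintype.card k - z = ∏ c : k, (z - algebraMap k K c) := by
  have hr := FiniteField.roots_X_pow_card_sub_X k
  have hd := FiniteField.X_pow_card_sub_X_natDegree_eq k (Fintype.one_lt_card (α := k))
  have hm : (X ^ Fintype.card k - X : k[X]).Monic :=
    monic_X_pow_sub (by rw [degree_X]; exact_mod_cast Fintype.one_lt_card (α := k))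
  have := prod_multiset_X_sub_C_of_monic_of_roots_card_eq hm
    (by rw [hr, hd]; rfl)
  rw [hr] at this
  have e := congrArg (aeval z) this
  change aeval z (∏ c : k, (X - C c)) = _ at e
  simpa [map_prod] using e.symm

lemma one_lt_of_one_le_pow_mul {θ a : Γ} (hθ : θ < 1) {n : ℕ} (h : 1 ≤ a ^ n * θ) : 1 < a := by
  by_contra! ha
  exact absurd h (not_le.2 ((mul_le_of_le_one_left' (pow_le_one' ha n)).trans_lt hθ))

lemma aeval_mem_of_map_mem {f : K →ₗ[k] K} {S : Submodule k K} (hfS : ∀ x ∈ S, f x ∈ S) (a : k[X])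
    {x : K} (hx : x ∈ S) : aeval f a x ∈ S := by
  induction a using Polynomial.induction_on' with
  | add a b ha hb => rw [map_add]; exact S.add_mem ha hb
  | monomial n c =>
    rw [aeval_monomial, Module.algebraMap_end_eq_smul_id, Module.End.mul_apply, LinearMap.smul_apply,
      LinearMap.id_apply, Module.End.pow_apply]
    refine S.smul_mem _ ?_
    induction n with
    | zero => exact hx
    | succ n ih => rw [Function.iterate_succ_apply']; exact hfS _ ih

/-- The `k`-linear map `f` is `x ↦ t x + x ^ Q + t ^ (q - 1) x ^ (Q q)`, where `t` lies in the
maximal ideal of the valuation `w`. -/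
structure IsTateMap (w : Valuation K Γ) (t : K) (Q q : ℕ) (f : K →ₗ[k] K) : Prop where
  lt_one : w t < 1
  two_le_Q : 2 ≤ Q
  two_le_q : 2 ≤ q
  apply_eq : ∀ x, f x = t * x + x ^ Q + t ^ (q - 1) * x ^ (Q * q)

namespace IsTateMap

variable {w : Valuation K Γ} {t : K} {Q q : ℕ} {f : K →ₗ[k] K} {S : Submodule k K}

lemma map_top_term (h : IsTateMap w t Q q f) (x : K) :
    w (t ^ (q - 1) * x ^ (Q * q)) = w x ^ Q * (w x ^ Q * w t) ^ (q - 1) := by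
  obtain ⟨m, rfl⟩ : ∃ m, q = m + 1 := ⟨q - 1, by have := h.two_le_q; omega⟩
  simp only [map_mul, map_pow, Nat.add_sub_cancel, mul_add_one, pow_add, mul_pow, ← pow_mul]
  ac_rfl

lemma map_linear_term_lt (h : IsTateMap w t Q q f) {x : K} (h1 : 1 < w x) :
    w (t * x) < w (x ^ Q) := by
  rw [map_mul, map_pow]
  exact (mul_lt_of_lt_one_left (zero_lt_one.trans h1) h.lt_one).trans_le
    (le_self_pow₀ h1.le (by have := h.two_le_Q; omega))

lemma map_of_one_lt_of_lt (h : IsTateMap w t Q q f) {x : K} (h1 : 1 < w x)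
    (hx : w x ^ Q * w t < 1) : w (f x) = w x ^ Q := by
  have e1 := h.map_linear_term_lt h1
  have e2 : w (t ^ (q - 1) * x ^ (Q * q)) < w (x ^ Q) := by
    rw [h.map_top_term, map_pow]
    exact mul_lt_of_lt_one_right (pow_pos (zero_lt_one.trans h1) _)
      (pow_lt_one₀ zero_le hx (by have := h.two_le_q; omega))
  have e3 : w (t * x + x ^ Q) = w (x ^ Q) := Valuation.map_add_eq_of_lt_right _ e1
  rw [h.apply_eq, Valuation.map_add_eq_of_lt_left _ (by rwa [e3]), e3, map_pow]

lemma map_le_one (h : IsTateMap w t Q q f) {x : K} (h1 : w x ≤ 1) : w (f x) ≤ 1 := by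
  rw [h.apply_eq]
  refine w.map_add_le (w.map_add_le ?_ ?_) ?_
  · rw [map_mul]; exact mul_le_one' h.lt_one.le h1
  · rw [map_pow]; exact pow_le_one' h1 _
  · rw [map_mul, map_pow, map_pow]
    exact mul_le_one' (pow_le_one' h.lt_one.le _) (pow_le_one' h1 _)

lemma lt_map_of_one_lt (h : IsTateMap w t Q q f) {x : K} (hx : 1 < w x ^ Q * w t) :
    w x < w (f x) ∧ 1 < w (f x) ^ Q * w t := by
  have h1 : 1 < w x := one_lt_of_one_le_pow_mul h.lt_one hx.le
  have hle : w x ≤ w x ^ Q := le_self_pow₀ h1.le (by have := h.two_le_Q; omega)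
  have e2 : w (x ^ Q) < w (t ^ (q - 1) * x ^ (Q * q)) := by
    rw [h.map_top_term, map_pow]
    exact lt_mul_of_one_lt_right (pow_pos (zero_lt_one.trans h1) _)
      (one_lt_pow₀ hx (by have := h.two_le_q; omega))
  have e3 : w (t * x + x ^ Q) = w (x ^ Q) :=
    Valuation.map_add_eq_of_lt_right _ (h.map_linear_term_lt h1)
  have e4 : w (f x) = w (t ^ (q - 1) * x ^ (Q * q)) := by
    rw [h.apply_eq, Valuation.map_add_eq_of_lt_right _ (by rwa [e3])]
  have e5 : w x < w (f x) := by
    rw [e4]; rw [map_pow] at e2; exact hle.trans_lt e2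
  exact ⟨e5, hx.trans_le (by gcongr)⟩

lemma pow_mul_le_one (h : IsTateMap w t Q q f) (hS : (S : Set K).Finite)
    (hfS : ∀ x ∈ S, f x ∈ S) {x : K} (hx : x ∈ S) : w x ^ Q * w t ≤ 1 := by
  by_contra! hlt
  obtain ⟨y, ⟨hyS, hy⟩, hmax⟩ := (hS.inter_of_left {y | 1 < w y ^ Q * w t}).exists_maximalFor w _
    ⟨x, hx, hlt⟩
  have := h.lt_map_of_one_lt hy
  exact absurd (hmax ⟨hfS y hyS, this.2⟩ this.1.le) (not_le.2 this.1)

lemma exists_pow_mul_eq_one (h : IsTateMap w t Q q f) (hS : (S : Set K).Finite)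
    (hfS : ∀ x ∈ S, f x ∈ S) {x : K} (hx : x ∈ S) (h1 : 1 < w x) :
    ∃ j, w x ^ Q ^ (j + 1) * w t = 1 := by
  by_contra! hne
  obtain ⟨y, ⟨hyS, hy1, hy⟩, hmax⟩ :=
    (hS.inter_of_left {y | 1 < w y ∧ ∀ j : ℕ, w y ^ Q ^ (j + 1) * w t ≠ 1}).exists_maximalFor w _
      ⟨x, hx, h1, hne⟩
  have e := h.map_of_one_lt_of_lt hy1
    ((h.pow_mul_le_one hS hfS hyS).lt_of_ne (by simpa using hy 0))
  have hlt : w y < w (f y) := by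
    rw [e]; exact lt_self_pow₀ hy1 (by have := h.two_le_Q; omega)
  refine absurd (hmax ⟨hfS y hyS, hy1.trans hlt, fun j hj => hy (j + 1) ?_⟩ hlt.le) (not_le.2 hlt)
  rw [← hj, e, ← pow_mul, ← pow_succ']

/-- A torsion point of level `J` has image of level `J - i` under `f^[i]`. -/
lemma map_iterate (h : IsTateMap w t Q q f) {x : K} {J : ℕ} (hx : w x ^ Q ^ (J + 1) * w t = 1)
    {i : ℕ} (hi : i ≤ J) : w (f^[i] x) = w x ^ Q ^ i := by
  have h1 : 1 < w x := one_lt_of_one_le_pow_mul h.lt_one hx.ge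
  have hQ := h.two_le_Q
  induction i with
  | zero => simp
  | succ i ih =>
    have ih := ih (by omega)
    rw [Function.iterate_succ_apply', h.map_of_one_lt_of_lt, ih, ← pow_mul, ← pow_succ]
    · rw [ih]; exact one_lt_pow₀ h1 (by positivity)
    · rw [ih, ← hx, ← pow_mul, ← pow_succ]
      have : w t ≠ 0 := fun h0 => by simp [h0] at hx
      refine mul_lt_mul_of_pos_right ?_ (zero_lt_iff.2 this)
      exact pow_lt_pow_right₀ h1 (Nat.pow_lt_pow_right (by omega) (by omega))

lemma map_aeval_le_one (h : IsTateMap w t Q q f) (hw : ∀ c : k, w (algebraMap k K c) ≤ 1)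
    (a : k[X]) {x : K} (hx : w x ≤ 1) : w (aeval f a x) ≤ 1 := by
  induction a using Polynomial.induction_on' with
  | add a b ha hb => rw [map_add]; exact w.map_add_le ha hb
  | monomial n c =>
    rw [aeval_monomial, Module.algebraMap_end_eq_smul_id, Module.End.mul_apply, LinearMap.smul_apply,
      LinearMap.id_apply, Module.End.pow_apply, Algebra.smul_def, map_mul]
    refine mul_le_one' (hw c) ?_
    induction n with
    | zero => exact hx
    | succ n ih => rw [Function.iterate_succ_apply']; exact h.map_le_one ih

section Residue

variable [Fintype k]

lemma exists_sub_smul_pow_mul_lt_one (h : IsTateMap w t Q q f) (hk : Fintype.card k = q)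
    (hadd : ∀ (c : k) (x y : K), (x - c • y) ^ Q = x ^ Q - c • y ^ Q)
    (hS : (S : Set K).Finite) (hfS : ∀ x ∈ S, f x ∈ S) {x y : K} (hx : x ∈ S) (hy : y ∈ S)
    (hx1 : w x ^ Q * w t = 1) (hy1 : w y ^ Q * w t = 1) :
    ∃ c : k, w (x - c • y) ^ Q * w t < 1 := by
  have hQ := h.two_le_Q
  have hq := h.two_le_q
  have key : ∀ z ∈ S, w z ^ Q * w t = 1 → w ((t * z ^ Q) ^ q + t * z ^ Q) < 1 := by
    intro z hz hz1
    have h1 : 1 < w z := one_lt_of_one_le_pow_mul h.lt_one hz1.ge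
    have ht0 : 0 < w t := zero_lt_iff.2 fun h0 => by simp [h0] at hz1
    have e : (t * z ^ Q) ^ q + t * z ^ Q = t * f z - t * (t * z) := by
      obtain ⟨m, rfl⟩ : ∃ m, q = m + 1 := ⟨q - 1, by omega⟩
      rw [h.apply_eq, Nat.add_sub_cancel, mul_pow, ← pow_mul]
      ring
    rw [e]
    refine w.map_sub_lt ?_ ?_
    · have hfz := h.pow_mul_le_one hS hfS (hfS z hz)
      rw [map_mul]
      rcases le_or_gt (w (f z)) 1 with hle | hlt
      · exact (mul_le_of_le_one_right' hle).trans_lt h.lt_one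
      · rw [mul_comm]
        exact (mul_lt_mul_of_pos_right (lt_self_pow₀ hlt (by omega)) ht0).trans_le hfz
    · rw [map_mul, map_mul]
      refine (mul_le_of_le_one_right' ?_).trans_lt h.lt_one
      rw [← hz1, mul_comm]
      gcongr
      exact le_self_pow₀ h1.le (by omega)
  set u := t * x ^ Q with hu
  set v := t * y ^ Q with hv
  have hwu : w u = 1 := by rw [hu, map_mul, map_pow, mul_comm, hx1]
  have hwv : w v = 1 := by rw [hv, map_mul, map_pow, mul_comm, hy1]
  have hv0 : v ≠ 0 := fun h0 => by simp [h0] at hwv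
  have hz : w ((u / v) ^ q - u / v) < 1 := by
    have e : (u / v) ^ q - u / v = ((u ^ q + u) - (u / v) * (v ^ q + v)) / v ^ q := by
      field_simp
      rw [div_pow]
      field_simp
      ring
    rw [e, map_div₀, map_pow, hwv, one_pow, div_one]
    refine Valuation.map_sub_lt _ (key x hx hx1) ?_
    rw [map_mul, map_div₀, hwu, hwv, div_one, one_mul]
    exact key y hy hy1
  have hprod : (u / v) ^ q - u / v = ∏ c : k, (u / v - algebraMap k K c) := by
    rw [← hk, pow_card_sub_eq_prod]
  obtain ⟨c, hc⟩ : ∃ c : k, w (u / v - algebraMap k K c) < 1 := by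
    by_contra! hc
    rw [hprod, map_prod] at hz
    exact absurd (Finset.one_le_prod' fun c _ => hc c) (not_le.2 hz)
  refine ⟨c, ?_⟩
  have e : t * (x - c • y) ^ Q = v * (u / v - algebraMap k K c) := by
    rw [mul_sub, mul_div_cancel₀ _ hv0, hadd, hu, hv, Algebra.smul_def]; ring
  rw [mul_comm, ← map_pow, ← map_mul, e, map_mul, hwv, one_mul]
  exact hc

lemma exists_sub_smul_level (h : IsTateMap w t Q q f) (hk : Fintype.card k = q)
    (hw : ∀ c : k, w (algebraMap k K c) ≤ 1)
    (hadd : ∀ (c : k) (x y : K), (x - c • y) ^ Q = x ^ Q - c • y ^ Q)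
    (hS : (S : Set K).Finite) (hfS : ∀ x ∈ S, f x ∈ S) (j : ℕ) :
    ∀ x ∈ S, ∀ y ∈ S, w x ^ Q ^ (j + 1) * w t = 1 → w y ^ Q ^ (j + 1) * w t = 1 →
    ∃ c : k, w (x - c • y) ^ Q ^ (j + 1) * w t < 1 := by
  have hQ := h.two_le_Q
  induction j with
  | zero =>
    intro x hx y hy hx1 hy1
    simp only [zero_add, pow_one] at *
    exact h.exists_sub_smul_pow_mul_lt_one hk hadd hS hfS hx hy hx1 hy1
  | succ j ih =>
    have step : ∀ z ∈ S, w z ^ Q ^ (j + 1 + 1) * w t = 1 →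
        w z ^ Q * w t < 1 ∧ w (f z) ^ Q ^ (j + 1) * w t = 1 := by
      intro z hz hz1
      have h1 := one_lt_of_one_le_pow_mul h.lt_one hz1.ge
      have ht0 : 0 < w t := zero_lt_iff.2 fun h0 => by simp [h0] at hz1
      have := h.map_iterate (i := 1) hz1 (by omega)
      simp only [Function.iterate_one, pow_one] at this
      refine ⟨?_, by rw [this, ← pow_mul, ← pow_succ', hz1]⟩
      rw [← hz1]
      refine mul_lt_mul_of_pos_right (pow_lt_pow_right₀ h1 ?_) ht0
      exact lt_self_pow₀ (by omega) (by omega)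
    intro x hx y hy hx1 hy1
    obtain ⟨c, hc⟩ := ih _ (hfS x hx) _ (hfS y hy) (step x hx hx1).2 (step y hy hy1).2
    refine ⟨c, ?_⟩
    rw [← map_smul, ← map_sub] at hc
    by_cases h1 : w (x - c • y) ≤ 1
    · exact (mul_le_of_le_one_left' (pow_le_one' h1 _)).trans_lt h.lt_one
    · push Not at h1
      have hcy : w (c • y) ≤ w y := by
        rw [Algebra.smul_def, map_mul]; exact mul_le_of_le_one_left' (hw c)
      have hlt : w (x - c • y) ^ Q * w t < 1 := by
        rcases le_max_iff.1 ((w.map_sub x (c • y)).trans (max_le_max le_rfl hcy)) with hle | hle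
        · exact lt_of_le_of_lt (by gcongr) (step x hx hx1).1
        · exact lt_of_le_of_lt (by gcongr) (step y hy hy1).1
      rwa [h.map_of_one_lt_of_lt h1 hlt, ← pow_mul, ← pow_succ'] at hc

/-- If some `l`-torsion point is not integral, then some `l`-torsion point has level at least
`deg l - 1`. -/
lemma exists_level_ge (h : IsTateMap w t Q q f) (hk : Fintype.card k = q)
    (hw : ∀ c : k, w (algebraMap k K c) ≤ 1)
    (hadd : ∀ (c : k) (x y : K), (x - c • y) ^ Q = x ^ Q - c • y ^ Q)
    (hS : (S : Set K).Finite) (hfS : ∀ x ∈ S, f x ∈ S) {l : k[X]} (hl : Irreducible l)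
    (hlS : ∀ x ∈ S, aeval f l x = 0) (hex : ∃ x ∈ S, 1 < w x) :
    ∃ x ∈ S, ∃ J, l.natDegree ≤ J + 1 ∧ w x ^ Q ^ (J + 1) * w t = 1 := by
  have hQ := h.two_le_Q
  obtain ⟨x, ⟨hxS, hx1⟩, hmin⟩ := (hS.inter_of_left {y | 1 < w y}).exists_minimalFor w _ hex
  obtain ⟨J, hJ⟩ := h.exists_pow_mul_eq_one hS hfS hxS hx1
  have ht0 : 0 < w t := zero_lt_iff.2 fun h0 => by simp [h0] at hJ
  refine ⟨x, hxS, J, ?_, hJ⟩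
  by_contra! hdeg
  have approx : ∀ j ≤ J + 1, ∃ a : k[X], a.degree < (J + 1 : ℕ) ∧
      w (aeval f (X ^ (J + 1) - a) x) ^ Q ^ j * w t < 1 := by
    intro j
    induction j with
    | zero =>
      refine fun _ => ⟨0, by simp, ?_⟩
      rw [pow_zero, pow_one, sub_zero]
      have hmem := aeval_mem_of_map_mem hfS (X ^ (J + 1) : k[X]) hxS
      set z := aeval f (X ^ (J + 1) : k[X]) x
      rcases le_or_gt (w z) 1 with hle | hlt
      · exact (mul_le_of_le_one_left' hle).trans_lt h.lt_one
      · exact (mul_lt_mul_of_pos_right (lt_self_pow₀ hlt (by omega)) ht0).trans_le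
          (h.pow_mul_le_one hS hfS hmem)
    | succ j ih =>
      intro hj
      obtain ⟨a, ha, hlt⟩ := ih (by omega)
      have hmem := aeval_mem_of_map_mem hfS (X ^ (J + 1) - a) hxS
      set z := aeval f (X ^ (J + 1) - a) x with hz
      rcases lt_trichotomy (w z ^ Q ^ (j + 1) * w t) 1 with hc | hc | hc
      · exact ⟨a, ha, hc⟩
      · have hy := h.map_iterate hJ (i := J - j) (by omega)
        have hfx : f^[J - j] x = aeval f (X ^ (J - j) : k[X]) x := by
          rw [map_pow, aeval_X, Module.End.pow_apply]
        obtain ⟨c, hc⟩ := h.exists_sub_smul_level hk hw hadd hS hfS j z hmem (f^[J - j] x)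
          (hfx ▸ aeval_mem_of_map_mem hfS _ hxS) hc (by
            rw [hy, ← pow_mul, ← pow_add, show J - j + (j + 1) = J + 1 by omega, hJ])
        refine ⟨a + c • X ^ (J - j), ?_, ?_⟩
        · refine (degree_add_le _ _).trans_lt (max_lt ha ?_)
          refine (degree_smul_le _ _).trans_lt ?_
          rw [degree_X_pow]
          exact_mod_cast (by omega : J - j < J + 1)
        · rw [hfx, hz, ← LinearMap.smul_apply, ← map_smul, ← LinearMap.sub_apply, ← map_sub,
            sub_sub] at hc
          exact hc
      · have hz1 := one_lt_of_one_le_pow_mul h.lt_one hc.le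
        obtain ⟨i, hi⟩ := h.exists_pow_mul_eq_one hS hfS hmem hz1
        rw [← hi, mul_lt_mul_iff_left₀ ht0, pow_lt_pow_iff_right₀ hz1,
          Nat.pow_lt_pow_iff_right (by omega)] at hlt hc
        omega
  obtain ⟨a, ha, hlt⟩ := approx (J + 1) le_rfl
  set b := X ^ (J + 1) - a with hb
  have hbm : b.Monic := monic_X_pow_sub ha
  have hbd : b.natDegree < l.natDegree := by
    refine lt_of_le_of_lt (natDegree_le_of_degree_le ?_) hdeg
    refine (degree_sub_le _ _).trans (max_le ?_ ha.le)
    rw [degree_X_pow]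
  have hz : w (aeval f b x) ≤ 1 := by
    by_contra! hgt
    have hle : w x ≤ w (aeval f b x) :=
      (le_total (w x) (w (aeval f b x))).elim id fun hle =>
        hmin ⟨aeval_mem_of_map_mem hfS b hxS, hgt⟩ hle
    exact absurd hlt (not_lt.2 (hJ.ge.trans (by gcongr)))
  have hco : IsCoprime l b := (hl.coprime_iff_not_dvd).2 fun hdvd =>
    absurd (natDegree_le_of_dvd hdvd hbm.ne_zero) (not_le.2 hbd)
  obtain ⟨u, v, huv⟩ := hco
  have hx : x = aeval f v (aeval f b x) := by
    have := congrArg (fun a => aeval f a x) huv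
    simpa [Module.End.mul_apply, hlS x hxS] using this.symm
  have := h.map_aeval_le_one hw v hz
  rw [← hx] at this
  exact absurd hx1 (not_lt.2 this)

end Residue
end IsTateMap
end Valuation

section Places

variable {k K : Type*} [Field k] [Field K] [Algebra k K]

/-- A transcendental element lies in the maximal ideal of some valuation ring over `k`. -/
lemma exists_valuationSubring_lt_one {t : K} (ht : Transcendental k t) :
    ∃ B : ValuationSubring K, B.valuation t < 1 ∧ ∀ c : k, B.valuation (algebraMap k K c) ≤ 1 := by
  let A : Subring K := (aeval t : k[X] →ₐ[k] K).toRingHom.range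
  let τ : A := ⟨t, X, by simp⟩
  have hI : Ideal.span {τ} ≠ ⊤ := by
    rw [Ne, Ideal.span_singleton_eq_top]
    intro hu
    obtain ⟨⟨_, p, rfl⟩, hp⟩ := hu.exists_right_inv
    have e : aeval t (X * p) = aeval t (1 : k[X]) := by
      simpa [τ] using congrArg Subtype.val hp
    exact not_isUnit_X (IsUnit.of_mul_eq_one _ (transcendental_iff_injective.1 ht e))
  obtain ⟨B, hB, hIB⟩ := Ideal.image_subset_nonunits_valuationSubring _ hI
  refine ⟨B, ?_, fun c => (B.valuation_le_one_iff _).2 (hB ⟨C c, by simp⟩)⟩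
  exact (ValuationSubring.mem_nonunits_iff B).1 (hIB ⟨τ, Ideal.mem_span_singleton_self _, rfl⟩)

variable {Γ : Type*} [LinearOrderedCommGroupWithZero Γ] {w : Valuation K Γ} {t : K}

lemma map_algebraMap_eq_one (hw : ∀ c : k, w (algebraMap k K c) ≤ 1) {c : k} (hc : c ≠ 0) :
    w (algebraMap k K c) = 1 := by
  refine le_antisymm (hw c) ?_
  have hc' : algebraMap k K c ≠ 0 := by simpa using hc
  have := hw c⁻¹
  rwa [map_inv₀, map_inv₀, inv_le_one₀ (zero_lt_iff.2 (w.ne_zero_iff.2 hc'))] at this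

lemma map_aeval_le_one (hw : ∀ c : k, w (algebraMap k K c) ≤ 1) (ht : w t ≤ 1) (p : k[X]) :
    w (aeval t p) ≤ 1 := by
  rw [aeval_eq_sum_range]
  refine w.map_sum_le fun i _ => ?_
  rw [Algebra.smul_def, map_mul, map_pow]
  exact mul_le_one' (hw _) (pow_le_one' ht _)

lemma one_le_map_aeval (hw : ∀ c : k, w (algebraMap k K c) ≤ 1) (ht : 1 < w t) (p : k[X]) :
    p ≠ 0 → 1 ≤ w (aeval t p) ∧ (p.coeff 0 = 0 → 1 < w (aeval t p)) := by
  induction p using Polynomial.recOnHorner with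
  | M0 => exact fun h => absurd rfl h
  | MC p c h0 hc ih =>
    intro _
    refine ⟨?_, fun h => absurd h (by simp [h0, hc])⟩
    rw [map_add, aeval_C]
    rcases eq_or_ne p 0 with rfl | hp
    · rw [map_zero, zero_add, map_algebraMap_eq_one hw hc]
    · have := (ih hp).2 h0
      rw [Valuation.map_add_eq_of_lt_left _ ((hw c).trans_lt this)]
      exact this.le
  | MX p hp0 ih =>
    intro _
    have : 1 < w (aeval t (p * X)) := by
      rw [map_mul, map_mul, aeval_X]
      exact ht.trans_le (le_mul_of_one_le_left' (ih hp0).1)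
    exact ⟨this.le, fun _ => this⟩

lemma exists_X_pow_dvd_and_map_aeval (hw : ∀ c : k, w (algebraMap k K c) ≤ 1) (ht : w t < 1)
    (p : k[X]) (hp : p ≠ 0) : ∃ m, X ^ m ∣ p ∧ w (aeval t p) = w t ^ m := by
  obtain ⟨r, hr, hdvd⟩ := exists_eq_pow_rootMultiplicity_mul_and_not_dvd p hp 0
  rw [C_0, sub_zero] at hr hdvd
  refine ⟨_, ⟨r, hr⟩, ?_⟩
  have hr1 : w (aeval t r) = 1 := by
    have h0 : r.coeff 0 ≠ 0 := by rwa [X_dvd_iff] at hdvd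
    rw [← divX_mul_X_add r, map_add, map_mul, aeval_X, aeval_C]
    rw [Valuation.map_add_eq_of_lt_right, map_algebraMap_eq_one hw h0]
    rw [map_algebraMap_eq_one hw h0, map_mul]
    exact (mul_le_of_le_one_left' (map_aeval_le_one hw ht.le _)).trans_lt ht
  conv_lhs => rw [hr]
  rw [map_mul, map_mul, hr1, mul_one, map_pow, aeval_X, map_pow]

/-- A nonzero torsion point of `x ↦ t x + x ^ Q + t ^ (q - 1) x ^ (Q q)` has positive valuation
at a place where `t` has a pole. -/
lemma map_lt_one_of_mem_of_one_lt {Q q : ℕ} {f : K →ₗ[k] K} (hQ : 2 ≤ Q) (hq : 3 ≤ q)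
    (hf : ∀ x, f x = t * x + x ^ Q + t ^ (q - 1) * x ^ (Q * q)) (ht : 1 < w t)
    {S : Submodule k K} (hS : (S : Set K).Finite) (hfS : ∀ x ∈ S, f x ∈ S) {x : K} (hx : x ∈ S) :
    w x < 1 := by
  have hq0 : 0 < q := by omega
  have hQ0 : 0 < Q := by omega
  have grow : ∀ y, 1 ≤ w y → w y < w (f y) := by
    intro y hy
    have hy0 : 0 < w y := zero_lt_one.trans_le hy
    have e1 : w (t * y) < w (t ^ (q - 1) * y ^ (Q * q)) := by
      simp only [map_mul, map_pow]
      refine (mul_lt_mul_of_pos_right (lt_self_pow₀ ht (by omega : 1 < q - 1)) hy0).trans_le ?_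
      exact mul_le_mul' le_rfl (le_self_pow₀ hy (by positivity))
    have e2 : w (y ^ Q) < w (t ^ (q - 1) * y ^ (Q * q)) := by
      simp only [map_mul, map_pow]
      refine (pow_le_pow_right₀ hy (Nat.le_mul_of_pos_right Q hq0)).trans_lt ?_
      exact lt_mul_of_one_lt_left (pow_pos hy0 _) (one_lt_pow₀ ht (by omega : q - 1 ≠ 0))
    rw [hf, Valuation.map_add_eq_of_lt_right _ (w.map_add_lt e1 e2)]
    simp only [map_mul, map_pow]
    refine (le_self_pow₀ hy (by positivity : Q * q ≠ 0)).trans_lt ?_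
    exact lt_mul_of_one_lt_left (pow_pos hy0 _) (one_lt_pow₀ ht (by omega : q - 1 ≠ 0))
  by_contra! hx1
  obtain ⟨y, ⟨hyS, hy⟩, hmax⟩ := (hS.inter_of_left {y | 1 ≤ w y}).exists_maximalFor w _
    ⟨x, hx, hx1⟩
  have := grow y hy
  exact absurd (hmax ⟨hfS y hyS, hy.trans this.le⟩ this.le) (not_le.2 this)

/-- An element whose valuation is an `M`-th root of a uniformizer up to inversion has degree at
least `M`. -/
lemma le_natDegree_of_map_pow_mul_eq_one {F : Type*} [Field F] [Algebra F K] (ht0 : 0 < w t)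
    (ht : w t < 1) (hF : ∀ a : F, a ≠ 0 → ∃ n : ℤ, w (algebraMap F K a) = w t ^ n)
    {x : K} {M : ℕ} (hx : w x ^ M * w t = 1) {p : F[X]} (hp : p ≠ 0) (hpx : aeval x p = 0) :
    M ≤ p.natDegree := by
  by_contra! hM
  have hx0 : w x ^ M = (w t)⁻¹ := eq_inv_of_mul_eq_one_left hx
  have hx0' : x ≠ 0 := by
    rintro rfl
    rw [map_zero, zero_pow (by omega)] at hx
    simp at hx
  have hterm : ∀ i ∈ p.support, ∃ n : ℤ, w (algebraMap F K (p.coeff i) * x ^ i) ^ M =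
      w t ^ (n * M - i) := by
    intro i hi
    obtain ⟨n, hn⟩ := hF _ (mem_support_iff.1 hi)
    refine ⟨n, ?_⟩
    rw [map_mul, hn, map_pow, mul_pow, ← pow_mul, mul_comm i M, pow_mul, hx0, zpow_sub₀ ht0.ne',
      zpow_mul, zpow_natCast, zpow_natCast, inv_pow, div_eq_mul_inv]
  have hinj : ∀ i ∈ p.support, ∀ j ∈ p.support,
      w (algebraMap F K (p.coeff i) * x ^ i) = w (algebraMap F K (p.coeff j) * x ^ j) → i = j := by
    intro i hi j hj hij
    obtain ⟨n, hn⟩ := hterm i hi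
    obtain ⟨m, hm⟩ := hterm j hj
    rw [hij, hm] at hn
    have e := (zpow_right_strictAnti₀ ht0 ht).injective hn
    have h1 := (le_natDegree_of_mem_supp i hi).trans_lt hM
    have h2 := (le_natDegree_of_mem_supp j hj).trans_lt hM
    have hmod : (i : ℤ) - j = (n - m) * M := by linear_combination e
    have hdvd : (M : ℤ) ∣ (i : ℤ) - j := ⟨n - m, by rw [hmod, mul_comm]⟩
    have := Int.eq_zero_of_abs_lt_dvd hdvd (by rw [abs_lt]; omega)
    omega
  obtain ⟨j, hj, hmax⟩ := p.support.exists_maximalFor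
    (fun i => w (algebraMap F K (p.coeff i) * x ^ i)) (support_nonempty.2 hp)
  have hne : w (algebraMap F K (p.coeff j) * x ^ j) ≠ 0 := by
    rw [w.ne_zero_iff]
    exact mul_ne_zero (by simpa using hj) (pow_ne_zero _ hx0')
  have hsum := Valuation.map_sum_eq_of_lt w (s := p.support)
    (f := fun i => algebraMap F K (p.coeff i) * x ^ i) hj (fun i hi => by
      have hi' := Finset.mem_sdiff.1 hi
      refine lt_of_le_of_ne ?_ fun h => ?_
      · exact (le_total _ _).elim id fun h => hmax hi'.1 h
      · exact hi'.2 (Finset.mem_singleton.2 (hinj i hi'.1 j hj h)))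
  rw [aeval_def, eval₂_eq_sum, Polynomial.sum] at hpx
  rw [hpx, map_zero] at hsum
  exact hne hsum.symm

end Places

section TorsionPolynomial

variable {k K : Type*} [Field k] [Field K] [Algebra k K] [Algebra k[X] K]

/-- The polynomial `T x + x ^ Q + T ^ (q - 1) x ^ (Q q)` over `k[T]`. -/
def twistedPoly (k : Type*) [Field k] (Q q : ℕ) : k[X][X] :=
  C X * X + X ^ Q + C (X ^ (q - 1)) * X ^ (Q * q)

/-- The `i`-fold composition of `twistedPoly k Q q` with itself. -/
def iterTwistedPoly (k : Type*) [Field k] (Q q : ℕ) : ℕ → k[X][X]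
  | 0 => X
  | i + 1 => (twistedPoly k Q q).comp (iterTwistedPoly k Q q i)

variable {Q q : ℕ}

lemma degree_twistedPoly_lower_lt (hQ : 2 ≤ Q) (hq : 2 ≤ q) :
    (C X * X + X ^ Q : k[X][X]).degree < (C (X ^ (q - 1)) * X ^ (Q * q) : k[X][X]).degree := by
  have hlt : Q < Q * q := by nlinarith
  rw [degree_C_mul_X_pow _ (pow_ne_zero _ X_ne_zero)]
  refine (degree_add_le _ _).trans_lt (max_lt ?_ ?_)
  · refine (degree_C_mul_X_le _).trans_lt ?_
    exact_mod_cast (by omega : 1 < Q * q)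
  · rw [degree_X_pow]
    exact_mod_cast hlt

lemma natDegree_twistedPoly (hQ : 2 ≤ Q) (hq : 2 ≤ q) :
    (twistedPoly k Q q).natDegree = Q * q := by
  rw [twistedPoly, natDegree_eq_of_degree_eq
    (degree_add_eq_right_of_degree_lt (degree_twistedPoly_lower_lt hQ hq)),
    natDegree_C_mul_X_pow _ _ (pow_ne_zero _ X_ne_zero)]

lemma leadingCoeff_twistedPoly (hQ : 2 ≤ Q) (hq : 2 ≤ q) :
    (twistedPoly k Q q).leadingCoeff = X ^ (q - 1) := by
  rw [twistedPoly, leadingCoeff_add_of_degree_lt (degree_twistedPoly_lower_lt hQ hq),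
    leadingCoeff_C_mul_X_pow]

lemma natDegree_iterTwistedPoly (hQ : 2 ≤ Q) (hq : 2 ≤ q) (i : ℕ) :
    (iterTwistedPoly k Q q i).natDegree = (Q * q) ^ i := by
  induction i with
  | zero => simp [iterTwistedPoly]
  | succ i ih => rw [iterTwistedPoly, natDegree_comp, ih, natDegree_twistedPoly hQ hq, pow_succ']

lemma exists_leadingCoeff_iterTwistedPoly (hQ : 2 ≤ Q) (hq : 2 ≤ q) (i : ℕ) :
    ∃ N, (iterTwistedPoly k Q q i).leadingCoeff = X ^ N := by
  induction i with
  | zero => exact ⟨0, by simp [iterTwistedPoly]⟩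
  | succ i ih =>
    obtain ⟨N, hN⟩ := ih
    refine ⟨q - 1 + N * (Q * q), ?_⟩
    rw [iterTwistedPoly, leadingCoeff_comp, hN, natDegree_twistedPoly hQ hq,
      leadingCoeff_twistedPoly hQ hq, ← pow_mul, ← pow_add]
    rw [natDegree_iterTwistedPoly hQ hq]
    positivity

lemma derivative_iterTwistedPoly (hQ0 : (Q : k) = 0) (i : ℕ) :
    derivative (iterTwistedPoly k Q q i) = C (X ^ i) := by
  have hQ1 : ((Q : ℕ) : k[X][X]) = 0 := by
    have := congrArg (fun c => (C (C c) : k[X][X])) hQ0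
    simpa using this
  induction i with
  | zero => simp [iterTwistedPoly]
  | succ i ih =>
    have : derivative (twistedPoly k Q q) = C X := by
      simp [twistedPoly, derivative_X_pow, hQ1, -map_pow]
    rw [iterTwistedPoly, derivative_comp, this, ih, C_comp, ← C_mul, pow_succ]

lemma aeval_iterTwistedPoly {f : K →ₗ[k] K} (hf : ∀ x, f x = algebraMap k[X] K X * x + x ^ Q +
    algebraMap k[X] K X ^ (q - 1) * x ^ (Q * q)) (i : ℕ) (x : K) :
    aeval x (iterTwistedPoly k Q q i) = f^[i] x := by
  induction i with
  | zero => simp [iterTwistedPoly]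
  | succ i ih =>
    rw [iterTwistedPoly, aeval_comp, ih, Function.iterate_succ_apply', hf]
    simp [twistedPoly]

/-- The polynomial over `k[T]` whose roots are the `l`-torsion points. -/
lemma exists_torsionPoly [IsScalarTower k k[X] K] {f : K →ₗ[k] K} (hQ : 2 ≤ Q)
    (hq : 2 ≤ q) (hQ0 : (Q : k) = 0)
    (hf : ∀ x, f x = algebraMap k[X] K X * x + x ^ Q +
      algebraMap k[X] K X ^ (q - 1) * x ^ (Q * q)) {l : k[X]} (hl : l.Monic) :
    ∃ P : k[X][X], (∀ x, aeval x P = aeval f l x) ∧ P.natDegree = (Q * q) ^ l.natDegree ∧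
      (∃ N, P.leadingCoeff = X ^ N) ∧ derivative P = C l := by
  have hQq : 1 < Q * q := by nlinarith
  set low : k[X][X] := ∑ i ∈ Finset.range l.natDegree, C (C (l.coeff i)) * iterTwistedPoly k Q q i
  set top := iterTwistedPoly k Q q l.natDegree with htop
  have hd := natDegree_iterTwistedPoly (k := k) hQ hq
  have htop0 : top ≠ 0 := fun h => by
    have := hd l.natDegree
    rw [← htop, h, natDegree_zero] at this
    exact (pow_pos (by omega) _).ne this
  have hlow : low.degree < top.degree := by
    rw [degree_eq_natDegree htop0, hd]
    refine (degree_sum_le _ _).trans_lt ((Finset.sup_lt_iff (WithBot.bot_lt_coe _)).2 ?_)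
    intro i hi
    rw [← smul_eq_C_mul]
    refine (degree_smul_le _ _).trans_lt (degree_le_natDegree.trans_lt ?_)
    rw [hd]
    exact_mod_cast Nat.pow_lt_pow_right hQq (Finset.mem_range.1 hi)
  refine ⟨top + low, fun x => ?_, ?_, ?_, ?_⟩
  · conv_rhs => rw [hl.as_sum]
    simp only [map_add, map_sum, map_mul, map_pow, aeval_X, low, top, LinearMap.add_apply,
      LinearMap.sum_apply, Module.End.mul_apply, aeval_iterTwistedPoly hf, Module.End.pow_apply,
      aeval_C, Module.algebraMap_end_apply]
    congr 1
    refine Finset.sum_congr rfl fun i _ => ?_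
    rw [Algebra.smul_def, IsScalarTower.algebraMap_apply k k[X] K, algebraMap_eq]
  · rw [natDegree_eq_of_degree_eq (degree_add_eq_left_of_degree_lt hlow), hd]
  · rw [leadingCoeff_add_of_degree_lt' hlow]
    exact exists_leadingCoeff_iterTwistedPoly hQ hq _
  · conv_rhs => rw [hl.as_sum]
    simp only [derivative_C_mul, derivative_iterTwistedPoly hQ0,
      map_add, map_sum, map_mul, map_pow, top, low]

end TorsionPolynomial

lemma aeval_algebraMap_X {k K : Type*} [Field k] [Field K] [Algebra k K] [Algebra k[X] K]
    [IsScalarTower k k[X] K] (p : k[X]) :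
    aeval (algebraMap k[X] K X) p = algebraMap k[X] K p := by
  rw [aeval_algebraMap_apply, aeval_X_left_apply]

lemma injective_algebraMap_polynomial (k K F : Type*) [Field k] [Field K] [Field F] [Algebra F K] [Algebra k[X] F]
    [IsFractionRing k[X] F] [Algebra k[X] K] [IsScalarTower k[X] F K] :
    Function.Injective (algebraMap k[X] K) := by
  rw [IsScalarTower.algebraMap_eq k[X] F K]
  exact (algebraMap F K).injective.comp (IsFractionRing.injective k[X] F)

lemma algebraMap_X_ne_zero (k K F : Type*) [Field k] [Field K] [Field F] [Algebra F K] [Algebra k[X] F]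
    [IsFractionRing k[X] F] [Algebra k[X] K] [IsScalarTower k[X] F K] :
    algebraMap k[X] K X ≠ 0 :=
  (map_ne_zero_iff _ (injective_algebraMap_polynomial k K F)).2 X_ne_zero

lemma transcendental_image_X (k K F : Type*) [Field k] [Field K] [Field F] [Algebra F K] [Algebra k[X] F]
    [IsFractionRing k[X] F] [Algebra k[X] K] [IsScalarTower k[X] F K]
    [Algebra k K] [IsScalarTower k k[X] K] : Transcendental k (algebraMap k[X] K X) := by
  rw [transcendental_iff_injective]
  intro a b hab
  rw [aeval_algebraMap_X, aeval_algebraMap_X] at hab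
  exact injective_algebraMap_polynomial k K F hab

section Torsion

variable {k K : Type*} [Field k] [Field K] [Algebra k K]

/-- A proper subspace of the `l`-torsion that is stable under `f` has codimension at least
`deg l`. -/
lemma pow_natDegree_mul_card_le [Fintype k] {f : K →ₗ[k] K} {l : k[X]} (hl : Irreducible l)
    {V : Submodule k K} (hfV : ∀ x ∈ V, f x ∈ V) (hlV : V < LinearMap.ker (aeval f l))
    (hfin : (LinearMap.ker (aeval f l) : Set K).Finite) :
    Fintype.card k ^ l.natDegree * Nat.card V ≤ Nat.card (LinearMap.ker (aeval f l)) := by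
  obtain ⟨hle, y, hy, hyV⟩ := SetLike.lt_iff_le_and_exists.1 hlV
  have hyW : ∀ a : k[X], aeval f a y ∈ LinearMap.ker (aeval f l) := by
    intro a
    rw [LinearMap.mem_ker] at hy ⊢
    rw [← Module.End.mul_apply, ← map_mul, mul_comm, map_mul, Module.End.mul_apply, hy, map_zero]
  have : Finite (LinearMap.ker (aeval f l)) := hfin
  let g : degreeLT k l.natDegree × V → LinearMap.ker (aeval f l) := fun z =>
    ⟨aeval f (z.1 : k[X]) y + z.2, add_mem (hyW _) (hle z.2.2)⟩
  have key : ∀ a : k[X], a ∈ degreeLT k l.natDegree → aeval f a y ∈ V → a = 0 := by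
    intro a ha haV
    by_contra ha0
    have hco : IsCoprime l a := (hl.coprime_iff_not_dvd).2 fun hdvd => by
      have := degree_le_of_dvd hdvd ha0
      rw [degree_eq_natDegree hl.ne_zero] at this
      exact absurd (mem_degreeLT.1 ha) (not_lt.2 this)
    obtain ⟨u, v, huv⟩ := hco
    refine hyV ?_
    have e : y = aeval f v (aeval f a y) := by
      have := congrArg (fun a => aeval f a y) huv
      simpa [Module.End.mul_apply, LinearMap.mem_ker.1 hy] using this.symm
    rw [e]
    exact aeval_mem_of_map_mem hfV v haV
  have hg : Function.Injective g := by
    rintro ⟨a, u⟩ ⟨b, v⟩ hab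
    have e : aeval f (a : k[X]) y + u = aeval f (b : k[X]) y + v := congrArg Subtype.val hab
    have hab : (a : k[X]) - (b : k[X]) = 0 := by
      refine key _ (sub_mem a.2 b.2) ?_
      have : aeval f ((a : k[X]) - (b : k[X])) y = v - u := by
        rw [map_sub, LinearMap.sub_apply]; linear_combination e
      rw [this]
      exact sub_mem v.2 u.2
    have hab := sub_eq_zero.1 hab
    rw [hab] at e
    exact Prod.ext (Subtype.ext hab) (Subtype.ext (add_left_cancel e))
  have := Nat.card_le_card_of_injective g hg
  rwa [Nat.card_prod, Nat.card_congr (degreeLTEquiv k l.natDegree).toEquiv, Nat.card_fun,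
    Nat.card_fin, Nat.card_eq_fintype_card] at this

variable {F : Type*} [Field F] [Algebra F K]

lemma mem_of_mem_aroots_minpoly [Normal F K] {S : Set K} (hS : ∀ σ : K ≃ₐ[F] K, ∀ x ∈ S, σ x ∈ S)
    {x y : K} (hx : x ∈ S) (hy : y ∈ (minpoly F x).aroots K) : y ∈ S := by
  obtain ⟨σ, rfl⟩ := minpoly.exists_algEquiv_of_root'
    (Algebra.IsAlgebraic.isAlgebraic x) (mem_aroots.1 hy).2
  exact hS σ x hx

lemma natDegree_minpoly_lt_card [Normal F K] [IsAlgClosed K] {V : Submodule k K}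
    (hfin : (V : Set K).Finite) (hV : ∀ σ : K ≃ₐ[F] K, ∀ x ∈ V, σ x ∈ V) {x : K}
    (hx : x ∈ V) (hx0 : x ≠ 0) (hsep : (minpoly F x).Separable) :
    (minpoly F x).natDegree < Nat.card V := by
  have hsub : (minpoly F x).rootSet K ⊂ V := by
    refine Set.ssubset_iff_subset_ne.2 ⟨fun y hy => ?_, fun h => ?_⟩
    · exact mem_of_mem_aroots_minpoly (S := (V : Set K)) hV hx
        (by rwa [mem_aroots, ← mem_rootSet])
    · have h0 : (0 : K) ∈ (minpoly F x).rootSet K := h ▸ V.zero_mem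
      rw [mem_rootSet] at h0
      rw [aeval_def, eval₂_at_zero, map_eq_zero_iff _ (algebraMap F K).injective] at h0
      rw [minpoly.coeff_zero_eq_zero (Algebra.IsIntegral.isIntegral x)] at h0
      exact hx0 h0.2
  have := Set.ncard_lt_ncard hsub hfin
  rwa [← Nat.card_coe_set_eq, Nat.card_eq_fintype_card, card_rootSet_eq_natDegree hsep
    (IsAlgClosed.splits _)] at this

variable [Algebra k[X] F] [IsFractionRing k[X] F] [Algebra k[X] K] [IsScalarTower k k[X] K]
  [IsScalarTower k[X] F K]

section Place

variable {Γ : Type*} [LinearOrderedCommGroupWithZero Γ] {w : Valuation K Γ}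

lemma exists_map_eq_zpow (hw : ∀ c : k, w (algebraMap k K c) ≤ 1)
    (ht : w (algebraMap k[X] K X) < 1) (a : F) (ha : a ≠ 0) :
    ∃ n : ℤ, w (algebraMap F K a) = w (algebraMap k[X] K X) ^ n := by
  obtain ⟨b, c, hc, rfl⟩ := IsFractionRing.div_surjective (A := k[X]) a
  have hb : b ≠ 0 := by
    rintro rfl
    simp at ha
  have ht0 : w (algebraMap k[X] K X) ≠ 0 := by
    rw [w.ne_zero_iff]
    exact algebraMap_X_ne_zero k K F
  obtain ⟨m, -, hm⟩ := exists_X_pow_dvd_and_map_aeval hw ht b hb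
  obtain ⟨n, -, hn⟩ := exists_X_pow_dvd_and_map_aeval hw ht c (nonZeroDivisors.ne_zero hc)
  rw [aeval_algebraMap_X] at hm hn
  refine ⟨m - n, ?_⟩
  rw [map_div₀, map_div₀, ← IsScalarTower.algebraMap_apply, ← IsScalarTower.algebraMap_apply,
    hm, hn, zpow_sub₀ ht0, zpow_natCast, zpow_natCast]

lemma exists_algebraMap_eq_of_pow_mul_eq (hw : ∀ c : k, w (algebraMap k K c) ≤ 1)
    (ht : w (algebraMap k[X] K X) < 1) {a : F} (ha : w (algebraMap F K a) ≤ 1) {N : ℕ}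
    {b : k[X]} (hb : algebraMap k[X] F X ^ N * a = algebraMap k[X] F b) :
    ∃ c : k[X], algebraMap k[X] F c = a := by
  have hX : algebraMap k[X] F X ≠ 0 := by simp
  rcases eq_or_ne b 0 with rfl | hb0
  · exact ⟨0, by simpa [hX, eq_comm (a := (0 : F))] using hb.symm⟩
  have ht0 : w (algebraMap k[X] K X) ≠ 0 := by
    rw [w.ne_zero_iff]
    exact algebraMap_X_ne_zero k K F
  obtain ⟨m, hmb, hm⟩ := exists_X_pow_dvd_and_map_aeval hw ht b hb0
  have hNm : N ≤ m := by
    have e := congrArg (fun z => w (algebraMap F K z)) hb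
    simp only [map_mul, map_pow, ← IsScalarTower.algebraMap_apply] at e
    rw [← aeval_algebraMap_X b, hm] at e
    rw [← pow_le_pow_iff_right_of_lt_one₀ (zero_lt_iff.2 ht0) ht, ← e]
    exact mul_le_of_le_one_right' ha
  obtain ⟨c, rfl⟩ := (pow_dvd_pow X hNm).trans hmb
  refine ⟨c, mul_left_cancel₀ (pow_ne_zero N hX) ?_⟩
  rw [hb, map_mul, map_pow]

end Place

lemma map_multiset_prod_eq {Γ : Type*} [LinearOrderedCommGroupWithZero Γ] (w : Valuation K Γ)
    (n : ℕ) (s : Multiset K) : w ((-1) ^ n * s.prod) = (s.map w).prod := by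
  rw [map_mul, map_pow, w.map_neg, map_one, one_pow, one_mul, map_multiset_prod]

/-- A Galois-stable nonzero subspace of the torsion is not integral at `T`. -/
lemma exists_one_lt_map [Normal F K] [IsAlgClosed K]
    {Γ : Type*} [LinearOrderedCommGroupWithZero Γ] {w : Valuation K Γ}
    (hw : ∀ c : k, w (algebraMap k K c) ≤ 1) (ht : w (algebraMap k[X] K X) < 1)
    {Q q : ℕ} (hQ : 2 ≤ Q) (hq : 3 ≤ q) {f : K →ₗ[k] K}
    (hf : ∀ x, f x = algebraMap k[X] K X * x + x ^ Q +
      algebraMap k[X] K X ^ (q - 1) * x ^ (Q * q)) {P : k[X][X]} {N : ℕ}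
    (hP : P.leadingCoeff = X ^ N) {V : Submodule k K} (hfin : (V : Set K).Finite)
    (hPV : ∀ x ∈ V, aeval x P = 0) (hfV : ∀ x ∈ V, f x ∈ V)
    (hV : ∀ σ : K ≃ₐ[F] K, ∀ x ∈ V, σ x ∈ V) (hV0 : V ≠ ⊥) : ∃ x ∈ V, 1 < w x := by
  by_contra! hle
  obtain ⟨x, hx, hx0⟩ := V.exists_mem_ne_zero_of_ne_bot hV0
  have hint : IsIntegral F x := Algebra.IsIntegral.isIntegral x
  have hroots : ∀ y ∈ (minpoly F x).aroots K, y ∈ V := fun y hy =>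
    mem_of_mem_aroots_minpoly (S := (V : Set K)) hV hx hy
  set s := (minpoly F x).aroots K with hs
  set c := (minpoly F x).coeff 0 with hc
  have hc0 : c ≠ 0 := by rwa [hc, Ne, minpoly.coeff_zero_eq_zero hint]
  have hprod : algebraMap F K c = (-1) ^ (minpoly F x).natDegree * s.prod := by
    have := (IsAlgClosed.splits ((minpoly F x).map (algebraMap F K))).coeff_zero_eq_prod_roots_of_monic
      ((minpoly.monic hint).map _)
    rwa [coeff_map, natDegree_map] at this
  have hxs : x ∈ s := mem_aroots.2 ⟨minpoly.ne_zero hint, minpoly.aeval F x⟩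
  have hintc : IsIntegral k[X] (algebraMap k[X] F X ^ (N * s.card) * c) := by
    rw [← isIntegral_algebraMap_iff (algebraMap F K).injective, map_mul, hprod]
    have : IsIntegral k[X] (s.map fun y => algebraMap k[X] K X ^ N * y).prod := by
      refine IsIntegral.multiset_prod fun z hz => ?_
      obtain ⟨y, hy, rfl⟩ := Multiset.mem_map.1 hz
      have := isIntegral_leadingCoeff_smul P y (hPV y (hroots y hy))
      rwa [hP, Algebra.smul_def, map_pow] at this
    rw [Multiset.prod_map_mul, Multiset.map_const', Multiset.prod_replicate, Multiset.map_id',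
      ← pow_mul] at this
    rw [map_pow, ← IsScalarTower.algebraMap_apply, mul_left_comm]
    exact ((isIntegral_one.neg).pow _).mul this
  obtain ⟨b, hb⟩ := IsIntegrallyClosed.isIntegral_iff.1 hintc
  obtain ⟨g, hg⟩ := exists_algebraMap_eq_of_pow_mul_eq hw ht (a := c) (by
    rw [hprod, map_multiset_prod_eq]
    refine (Multiset.prod_le_pow_card _ 1 fun z hz => ?_).trans (one_pow _).le
    obtain ⟨y, hy, rfl⟩ := Multiset.mem_map.1 hz
    exact hle y (hroots y hy)) hb.symm
  have hg0 : g ≠ 0 := by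
    rintro rfl
    exact hc0 (by rw [← hg, map_zero])
  have htr := transcendental_image_X k K F
  obtain ⟨B, hB, hBk⟩ := exists_valuationSubring_lt_one (k := k) (t := (algebraMap k[X] K X)⁻¹)
    fun h => htr (by simpa using h.inv)
  have hBt : 1 < B.valuation (algebraMap k[X] K X) := by
    rwa [map_inv₀, inv_lt_one₀ (zero_lt_iff.2
      (B.valuation.ne_zero_iff.2 (algebraMap_X_ne_zero k K F)))] at hB
  have h1 := (one_le_map_aeval hBk hBt g hg0).1
  rw [aeval_algebraMap_X, IsScalarTower.algebraMap_apply k[X] F K, hg, hprod,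
    map_multiset_prod_eq] at h1
  obtain ⟨s', hs'⟩ := Multiset.exists_cons_of_mem hxs
  have hlt : ∀ y ∈ s, B.valuation y < 1 := fun y hy =>
    map_lt_one_of_mem_of_one_lt hQ hq hf hBt hfin hfV (hroots y hy)
  rw [hs', Multiset.map_cons, Multiset.prod_cons] at h1
  refine absurd h1 (not_le.2 ((mul_le_of_le_one_right' ?_).trans_lt (hlt x hxs)))
  refine (Multiset.prod_le_pow_card _ 1 fun z hz => ?_).trans (one_pow _).le
  obtain ⟨y, hy, rfl⟩ := Multiset.mem_map.1 hz
  exact (hlt y (hs' ▸ Multiset.mem_cons_of_mem hy)).le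

/-- The torsion of an irreducible polynomial has no proper nonzero Galois-stable subspace. -/
lemma eq_ker_of_ne_bot [Normal F K] [IsAlgClosed K] [Fintype k] {Q q : ℕ} (hQ : 2 ≤ Q) (hq : 3 ≤ q)
    (hQ0 : (Q : k) = 0) (hk : Fintype.card k = q)
    (hadd : ∀ (c : k) (x y : K), (x - c • y) ^ Q = x ^ Q - c • y ^ Q) {f : K →ₗ[k] K}
    (hf : ∀ x, f x = algebraMap k[X] K X * x + x ^ Q +
      algebraMap k[X] K X ^ (q - 1) * x ^ (Q * q)) {l : k[X]} (hlm : l.Monic) (hl : Irreducible l)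
    {V : Submodule k K} (hlV : V ≤ LinearMap.ker (aeval f l)) (hfV : ∀ x ∈ V, f x ∈ V)
    (hV : ∀ σ : K ≃ₐ[F] K, ∀ x ∈ V, σ x ∈ V) (hV0 : V ≠ ⊥) : V = LinearMap.ker (aeval f l) := by
  by_contra hne
  obtain ⟨P, hPf, hPd, ⟨N, hPN⟩, hP'⟩ := exists_torsionPoly hQ (by omega) hQ0 hf hlm
  have hP0 : P ≠ 0 := by
    rintro rfl
    exact pow_ne_zero N X_ne_zero (hPN.symm.trans leadingCoeff_zero)
  have hinj := injective_algebraMap_polynomial k K F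
  have hroot : (LinearMap.ker (aeval f l) : Set K) = P.rootSet K := by
    ext x
    rw [SetLike.mem_coe, LinearMap.mem_ker, ← hPf, mem_rootSet', and_iff_right]
    rwa [Ne, Polynomial.map_eq_zero_iff hinj]
  have hfin : (LinearMap.ker (aeval f l) : Set K).Finite := hroot ▸ P.rootSet_finite K
  have hcard : Nat.card (LinearMap.ker (aeval f l)) ≤ (Q * q) ^ l.natDegree := by
    rw [← hPd, ← SetLike.coe_sort_coe, hroot, Nat.card_coe_set_eq,
      ← natDegree_map_eq_of_injective hinj]
    classical
    rw [rootSet, Set.ncard_coe_finset]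
    exact (Multiset.toFinset_card_le _).trans (card_roots' _)
  have hVfin : (V : Set K).Finite := hfin.subset hlV
  have hPV : ∀ x ∈ V, aeval x P = 0 := fun x hx => by rw [hPf]; exact hlV hx
  obtain ⟨B, hB, hBk⟩ := exists_valuationSubring_lt_one (transcendental_image_X k K F)
  have hex := exists_one_lt_map hBk hB hQ hq hf hPN hVfin hPV hfV hV hV0
  have hT : IsTateMap B.valuation (algebraMap k[X] K X) Q q f := ⟨hB, hQ, by omega, hf⟩
  obtain ⟨x, hx, J, hJ, hxJ⟩ := hT.exists_level_ge hk hBk hadd hVfin hfV hl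
    (fun x hx => hlV hx) hex
  have hx0 : x ≠ 0 := by
    rintro rfl
    rw [map_zero, zero_pow (by positivity), zero_mul] at hxJ
    exact zero_ne_one hxJ
  have hsep : (minpoly F x).Separable := by
    have : (P.map (algebraMap k[X] F)).Separable := by
      rw [Polynomial.Separable, derivative_map, hP', map_C]
      have hl0 : algebraMap k[X] F l ≠ 0 := by simpa using hlm.ne_zero
      exact ⟨0, C (algebraMap k[X] F l)⁻¹, by
        rw [zero_mul, zero_add, ← C_mul, inv_mul_cancel₀ hl0, C_1]⟩
    exact this.of_dvd (minpoly.dvd F x (by rw [aeval_map_algebraMap]; exact hPV x hx))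
  have h1 := le_natDegree_of_map_pow_mul_eq_one (F := F) (w := B.valuation)
    (zero_lt_iff.2 (B.valuation.ne_zero_iff.2 (algebraMap_X_ne_zero k K F))) hB
    (exists_map_eq_zpow hBk hB) hxJ (minpoly.ne_zero (Algebra.IsIntegral.isIntegral x))
    (minpoly.aeval F x)
  have h2 := natDegree_minpoly_lt_card hVfin hV hx hx0 hsep
  have h3 := (pow_natDegree_mul_card_le hl hfV (hlV.lt_of_ne hne) hfin).trans hcard
  rw [hk, mul_pow, mul_comm] at h3
  have h4 := Nat.le_of_mul_le_mul_right h3 (by positivity)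
  have h5 : Q ^ l.natDegree ≤ Q ^ (J + 1) := Nat.pow_le_pow_right (by omega) hJ
  omega

end Torsion

/-- Assume `p > r!`. For every nonzero prime `𝔩 = (l) ≠ (T)` and every Galois-stable
proper nonzero `𝔽_𝔩`-subspace `V` of `φ[𝔩]`, the `𝔽_𝔩`-dimension `d` of `V` (expressed
via `|V| = |𝔽_𝔩|^d` with `|𝔽_𝔩| = q^{deg l}`) satisfies `2 ≤ d ≤ r - 2`. -/
theorem stable_subspace_dim_ge_two_le_r_sub_two
    (p e q r : ℕ) (hp : p.Prime) (hp5 : 5 ≤ p) (he : 0 < e) (hq : q = p ^ e)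
    (hr : r.Prime) (hr3 : 3 ≤ r) (hfac : r.factorial < p)
    (Fq : Type) [Field Fq] [Fintype Fq] (hFq : Fintype.card Fq = q)
    (φ : Polynomial Fq →+* AddMonoid.End (Kbar Fq)) (hφ : IsDrinfeldPhi Fq q r φ)
    (l : Polynomial Fq) (hlm : l.Monic) (hl : Irreducible l) (hlX : l ≠ X)
    (V : Set (Kbar Fq)) (hV : IsGaloisStableSubspace Fq φ l V)
    (hV0 : V ≠ {0}) (hVtop : V ≠ phiTorsion Fq φ l) :
    ∃ d : ℕ, 2 ≤ d ∧ d ≤ r - 2 ∧ Nat.card V = (q ^ l.natDegree) ^ d := by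
  have hq5 : 5 ≤ q := hq ▸ hp5.trans (Nat.le_self_pow he.ne' p)
  have := Fact.mk hp
  have : CharP Fq p := charP_of_card_eq_prime_pow (hFq.trans hq)
  have : CharP (Kbar Fq) p := charP_of_injective_algebraMap (algebraMap Fq (Kbar Fq)).injective p
  obtain ⟨hφC, hφX⟩ := hφ
  obtain ⟨hVl, hV0mem, hVadd, hVφ, hVσ⟩ := hV
  have hsmul : ∀ (c : Fq) (x : Kbar Fq), c • x = φ (C c) x := fun c x => by
    rw [hφC, Algebra.smul_def, IsScalarTower.algebraMap_apply Fq (RatFunc Fq) (Kbar Fq),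
      RatFunc.algebraMap_eq_C]
  have hφmul : ∀ (a b : Fq[X]) (x : Kbar Fq), φ (a * b) x = φ a (φ b x) := fun a b x => by
    rw [map_mul]; rfl
  let f : Kbar Fq →ₗ[Fq] Kbar Fq :=
    { toFun := φ X
      map_add' := map_add _
      map_smul' := fun c x => by
        rw [RingHom.id_apply, hsmul, hsmul, ← hφmul, ← hφmul, mul_comm] }
  have hfφ : ∀ (a : Fq[X]) x, aeval f a x = φ a x := by
    intro a x
    induction a using Polynomial.induction_on generalizing x with
    | C c => rw [aeval_C, Module.algebraMap_end_apply, hsmul]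
    | add a b ha hb => rw [map_add, map_add, LinearMap.add_apply, ha, hb]; rfl
    | monomial n c ih =>
      rw [pow_succ, ← mul_assoc, map_mul, Module.End.mul_apply, hφmul, ih, aeval_X]
      rfl
  let W : Submodule Fq (Kbar Fq) :=
    { carrier := V
      add_mem' := fun {x y} hx hy => hVadd x hx y hy
      zero_mem' := hV0mem
      smul_mem' := fun c x hx => hsmul c x ▸ hVφ _ x hx }
  have hqr : q ^ r = q ^ (r - 1) * q := by rw [← pow_succ, Nat.sub_add_cancel (by omega)]
  have hker : (LinearMap.ker (aeval f l) : Set (Kbar Fq)) = phiTorsion Fq φ l := by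
    ext x
    rw [SetLike.mem_coe, LinearMap.mem_ker, hfφ]
    rfl
  have hXX : algebraMap Fq[X] (Kbar Fq) X = algebraMap (RatFunc Fq) (Kbar Fq) RatFunc.X := by
    rw [IsScalarTower.algebraMap_apply Fq[X] (RatFunc Fq) (Kbar Fq), RatFunc.algebraMap_X]
  have hW : W = LinearMap.ker (aeval f l) := by
    refine eq_ker_of_ne_bot (F := RatFunc Fq) (Q := q ^ (r - 1)) (q := q) ?_ (by omega) ?_ hFq ?_
      (fun x => ?_) hlm hl ?_ (fun x hx => hVφ X x hx) hVσ ?_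
    · exact (by omega : 2 ≤ q).trans (Nat.le_self_pow (by omega) q)
    · rw [Nat.cast_pow, ← hFq, FiniteField.cast_card_eq_zero, zero_pow (by omega)]
    · intro c x y
      have hc : c ^ q ^ (r - 1) = c := by rw [← hFq, FiniteField.pow_card_pow]
      rw [hq, ← pow_mul, sub_pow_char_pow, _root_.smul_pow, pow_mul, ← hq, hc]
    · rw [hXX, ← hqr]
      exact hφX x
    · rw [← SetLike.coe_subset_coe, hker]
      exact hVl
    · rw [Ne, ← SetLike.coe_set_eq]
      exact hV0
  exact absurd ((congrArg SetLike.coe hW).trans hker) hVtop
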